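/- The MAC N_PBR can be simulated with 1 classical bit from each sender assisted by a shared two-qubit maximally entangled state on each sender–receiver line: there exist, for each x ∈ {0,1}², an orthonormal basis {u_x⁰, u_x¹} of ℂ²; for each y ∈ {0,1}², an orthonormal basis {v_y⁰, v_y¹} of ℂ²; and for each (b₁,b₂) ∈ {0,1}², a POVM {Π_a^{b₁b₂}}_{a ∈ {0,1}²} on ℂ²⊗ℂ² (positive semidefinite operators with Σ_a Π_a^{b₁b₂} = I), such that for all a,x,y ∈ {0,1}²: N_PBR(a|x,y) = Σ_{b₁,b₂ ∈ {0,1}} ⟨Φ| (|u_x^{b₁}⟩⟨u_x^{b₁}| ⊗ |v_y^{b₂}⟩⟨v_y^{b₂}| ⊗ Π_a^{b₁b₂}) |Φ⟩, where Φ = (1/2) Σ_{i,j ∈ {0,1}} |i⟩⊗|j⟩⊗|i⟩⊗|j⟩ ∈ (ℂ²)^{⊗4} is the tensor product of two maximally entangled states, with the four tensor factors ordered as (sender-1 half, sender-2 half, receiver's half of line 1, receiver's half of line 2). -/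

import Mathlib

open Matrix Kronecker
open scoped ComplexOrder

noncomputable section

/-- Outer product `|v⟩⟨v|`. -/
def outer {α : Type*} (v : α → ℂ) : Matrix α α ℂ :=
  Matrix.of fun i j => v i * star (v j)

/-- Bitwise XOR of two-bit strings. -/
def xor2 (x y : Bool × Bool) : Bool × Bool := (xor x.1 y.1, xor x.2 y.2)

/-- Bitwise complement of a two-bit string. -/
def compl2 (s : Bool × Bool) : Bool × Bool := (!s.1, !s.2)

/-- The PBR multiple access channel. -/
def NPBR (a x y : Bool × Bool) : ℝ :=
  if a = xor2 x y then 1 / 2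
  else if a = compl2 (xor2 x y) then 0
  else 1 / 4

/-- The tensor product of two maximally entangled states, with the four qubit
factors ordered as (sender-1 half, sender-2 half, receiver half 1,
receiver half 2): `Φ = (1/2) Σ_{i,j} |i⟩⊗|j⟩⊗|i⟩⊗|j⟩`. -/
def PhiEnt : (Fin 2 × Fin 2) × (Fin 2 × Fin 2) → ℂ :=
  fun p => if p.1.1 = p.2.1 ∧ p.1.2 = p.2.2 then 1 / 2 else 0

/-- The sign `(-1)^b`. -/
def boolSign (b : Bool) : ℂ := if b then -1 else 1

lemma boolSign_xor (a b : Bool) : boolSign (xor a b) = boolSign a * boolSign b := by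
  cases a <;> cases b <;> simp [boolSign]

lemma boolSign_mul_self (b : Bool) : boolSign b * boolSign b = 1 := by
  cases b <;> simp [boolSign]

lemma star_boolSign (b : Bool) : star (boolSign b) = boolSign b := by
  cases b <;> simp [boolSign]

/-- The senders' bases: the computational basis if the two input bits agree, the Hadamard basis
otherwise, ordered according to the first input bit. -/
def senderBasis (x : Bool × Bool) (b : Bool) : Fin 2 → ℂ :=
  if x.1 = x.2 then Pi.single (if xor x.1 b then 1 else 0) 1
  else ![((√2)⁻¹ : ℝ), boolSign (xor x.1 b) * ((√2)⁻¹ : ℝ)]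

lemma ofReal_inv_sqrt_two_mul_self : (((√2)⁻¹ : ℝ) : ℂ) * ((√2)⁻¹ : ℝ) = 1 / 2 := by
  rw [← Complex.ofReal_mul, ← mul_inv, Real.mul_self_sqrt (by norm_num)]
  norm_num

lemma senderBasis_orthonormal (x : Bool × Bool) (b b' : Bool) :
    (∑ i, star (senderBasis x b i) * senderBasis x b' i) = if b = b' then 1 else 0 := by
  have h := ofReal_inv_sqrt_two_mul_self
  generalize hr : (√2)⁻¹ = r at h
  obtain ⟨x₁, x₂⟩ := x
  cases x₁ <;> cases x₂ <;> cases b <;> cases b' <;>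
    simp [senderBasis, boolSign, hr, -Complex.ofReal_inv] <;> linear_combination 2 * h

lemma outer_senderBasis (x : Bool × Bool) (b : Bool) :
    outer (senderBasis x b) =
      !![1 / 2 + boolSign b * (boolSign x.1 + boolSign x.2) / 4,
          boolSign b * (boolSign x.1 - boolSign x.2) / 4;
        boolSign b * (boolSign x.1 - boolSign x.2) / 4,
          1 / 2 - boolSign b * (boolSign x.1 + boolSign x.2) / 4] := by
  have h := ofReal_inv_sqrt_two_mul_self
  generalize hr : (√2)⁻¹ = r at h
  obtain ⟨x₁, x₂⟩ := x
  ext i j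
  cases x₁ <;> cases x₂ <;> cases b <;> fin_cases i <;> fin_cases j <;>
    simp [outer, senderBasis, boolSign, hr, -Complex.ofReal_inv] <;> norm_num <;>
    linear_combination h

/-- The rank-one projector `(1 + s A ⊗ A + t B ⊗ B + s t AB ⊗ AB) / 4` with
`A = (Z + X) / √2`, `B = (Z - X) / √2` and signs `s`, `t`. -/
def bellProjector (s t : ℂ) : Matrix (Fin 2 × Fin 2) (Fin 2 × Fin 2) ℂ :=
  (1 / 4 : ℂ) • (1 + (s / 2) • (!![1, 1; 1, -1] ⊗ₖ !![1, 1; 1, -1])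
    + (t / 2) • (!![1, -1; -1, -1] ⊗ₖ !![1, -1; -1, -1])
    + (s * t) • (!![0, -1; 1, 0] ⊗ₖ !![0, -1; 1, 0]))

lemma bellProjector_posSemidef (a b : Bool) :
    (bellProjector (boolSign a) (boolSign b)).PosSemidef := by
  have ha := boolSign_mul_self a
  have hb := boolSign_mul_self b
  have ha' := star_boolSign a
  have hb' := star_boolSign b
  generalize boolSign a = s at *
  generalize boolSign b = t at *
  have h : bellProjector s t = (bellProjector s t)ᴴ * bellProjector s t := by
    ext ⟨i, j⟩ ⟨k, l⟩
    simp only [Matrix.mul_apply, Fintype.sum_prod_type, Fin.sum_univ_two,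
      Matrix.conjTranspose_apply]
    fin_cases i <;> fin_cases j <;> fin_cases k <;> fin_cases l <;>
      simp [bellProjector] at ha' hb' ⊢ <;> rw [ha', hb'] <;> grind
  rw [h]
  exact Matrix.posSemidef_conjTranspose_mul_self _

/-- The receiver's measurement. -/
def receiverPOVM (b₁ b₂ : Bool) (a : Bool × Bool) :
    Matrix (Fin 2 × Fin 2) (Fin 2 × Fin 2) ℂ :=
  bellProjector (boolSign (xor a.1 (xor b₁ b₂))) (boolSign (xor a.2 (xor b₁ b₂)))

lemma sum_receiverPOVM (b₁ b₂ : Bool) : ∑ a, receiverPOVM b₁ b₂ a = 1 := by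
  ext p q
  simp only [receiverPOVM, bellProjector, boolSign_xor, Fintype.sum_prod_type, Fintype.sum_bool,
    Matrix.add_apply, Matrix.smul_apply, smul_eq_mul]
  rw [show boolSign true = -1 from rfl, show boolSign false = 1 from rfl]
  ring

lemma PhiEnt_expectation (A P : Matrix (Fin 2 × Fin 2) (Fin 2 × Fin 2) ℂ) :
    star PhiEnt ⬝ᵥ ((A ⊗ₖ P) *ᵥ PhiEnt) = 1 / 4 * ∑ p, ∑ q, A p q * P p q := by
  have h (p q : Fin 2 × Fin 2) : PhiEnt (p, q) = if p = q then 1 / 2 else 0 := by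
    simp [PhiEnt, Prod.ext_iff]
  simp only [dotProduct, Matrix.mulVec, Pi.star_apply, Fintype.sum_prod_type (α₁ := Fin 2 × Fin 2),
    h, Matrix.kroneckerMap_apply]
  simp only [apply_ite star, star_zero, ite_mul, mul_ite, mul_zero, zero_mul, Finset.sum_ite_eq,
    Finset.mem_univ, if_true]
  simp only [Finset.mul_sum]
  refine Finset.sum_congr rfl fun p _ => Finset.sum_congr rfl fun q _ => ?_
  simp
  ring

lemma expectation_receiverPOVM (a x y : Bool × Bool) (b₁ b₂ : Bool) :
    star PhiEnt ⬝ᵥ (((outer (senderBasis x b₁) ⊗ₖ outer (senderBasis y b₂)) ⊗ₖ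
      receiverPOVM b₁ b₂ a) *ᵥ PhiEnt) =
      1 / 16 + boolSign a.1 * boolSign x.1 * boolSign y.1 / 32
        + boolSign a.2 * boolSign x.2 * boolSign y.2 / 32 := by
  have h₁ := boolSign_mul_self b₁
  have h₂ := boolSign_mul_self b₂
  rw [PhiEnt_expectation, outer_senderBasis, outer_senderBasis]
  simp only [receiverPOVM, bellProjector, boolSign_xor, Fintype.sum_prod_type, Fin.sum_univ_two,
    Matrix.add_apply, Matrix.smul_apply, smul_eq_mul, Matrix.one_apply, Matrix.kroneckerMap_apply]
  simp
  linear_combination (boolSign a.1 * boolSign x.1 * boolSign y.1 / 32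
        + boolSign a.2 * boolSign x.2 * boolSign y.2 / 32) *
        (boolSign b₂ * boolSign b₂ * h₁ + h₂)

lemma NPBR_eq_boolSign (a x y : Bool × Bool) :
    (NPBR a x y : ℂ) = 1 / 4 + boolSign a.1 * boolSign x.1 * boolSign y.1 / 8
      + boolSign a.2 * boolSign x.2 * boolSign y.2 / 8 := by
  obtain ⟨a₁, a₂⟩ := a
  obtain ⟨x₁, x₂⟩ := x
  obtain ⟨y₁, y₂⟩ := y
  cases a₁ <;> cases a₂ <;> cases x₁ <;> cases x₂ <;> cases y₁ <;> cases y₂ <;>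
    simp [NPBR, xor2, compl2, boolSign] <;> norm_num

/-- `NPBR` can be simulated with 1 classical bit from each sender assisted by
a shared two-qubit maximally entangled state on each sender–receiver line. -/
theorem entanglement_assisted_cbit_simulation_of_NPBR :
    ∃ (u v : Bool × Bool → Bool → (Fin 2 → ℂ))
      (Pi : Bool → Bool → (Bool × Bool) → Matrix (Fin 2 × Fin 2) (Fin 2 × Fin 2) ℂ),
      (∀ x b b', (∑ i, star (u x b i) * u x b' i) = if b = b' then 1 else 0) ∧
      (∀ y b b', (∑ i, star (v y b i) * v y b' i) = if b = b' then 1 else 0) ∧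
      (∀ b₁ b₂ a, (Pi b₁ b₂ a).PosSemidef) ∧
      (∀ b₁ b₂, (∑ a : Bool × Bool, Pi b₁ b₂ a) = 1) ∧
      (∀ a x y : Bool × Bool,
        (NPBR a x y : ℂ) =
          ∑ b₁ : Bool, ∑ b₂ : Bool,
            star PhiEnt ⬝ᵥ
              (((outer (u x b₁) ⊗ₖ outer (v y b₂)) ⊗ₖ Pi b₁ b₂ a) *ᵥ PhiEnt)) := by
  refine ⟨senderBasis, senderBasis, receiverPOVM, senderBasis_orthonormal,
    senderBasis_orthonormal, fun _ _ _ => bellProjector_posSemidef _ _, sum_receiverPOVM,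
    fun a x y => ?_⟩
  simp only [expectation_receiverPOVM, NPBR_eq_boolSign, Fintype.sum_bool]
  ring
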